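/- arXiv:2209.02896 — 6 statements merged into one kernel-verified Lean document; each statement's English description precedes it below -/
import Mathlib

section
/- For every real x with |x| ≤ 1/2 and every real c ≥ 0, it holds that (exp(−x)/(1 − x)) · exp(c/(1 − x)) ≤ exp(x² + 2c). -/
/-- Key scalar inequality in the proof of Lemma 1 of the paper:
for `|x| ≤ 1/2` and `c ≥ 0`, `(e^{−x}/(1 − x))·e^{c/(1 − x)} ≤ e^{x² + 2c}`. -/
theorem mgf_scalar_bound (x c : ℝ) (hx : |x| ≤ 1 / 2) (hc : 0 ≤ c) :
    (Real.exp (-x) / (1 - x)) * Real.exp (c / (1 - x)) ≤ Real.exp (x ^ 2 + 2 * c) := by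
  obtain ⟨h1, h2⟩ := abs_le.mp hx
  have hpos : 0 < 1 - x := by linarith
  have key : 1 ≤ (1 - x) * Real.exp (x + x ^ 2) := by
    rcases le_total 0 x with h | h
    · have hq := Real.quadratic_le_exp_of_nonneg (x := x + x ^ 2) (by positivity)
      refine le_trans ?_ (mul_le_mul_of_nonneg_left hq hpos.le)
      have h3 : 0 ≤ 1 - x - x ^ 2 - x ^ 3 := by
        have a : x ^ 2 ≤ (1 / 2) ^ 2 := by gcongr
        have b : x ^ 3 ≤ (1 / 2) ^ 3 := by gcongr
        norm_num at a b
        linarith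
      have h4 := mul_nonneg (sq_nonneg x) h3
      nlinarith [h4]
    · have hq := Real.add_one_le_exp (x + x ^ 2)
      refine le_trans ?_ (mul_le_mul_of_nonneg_left hq hpos.le)
      nlinarith [mul_nonneg (sq_nonneg x) (neg_nonneg.mpr h)]
  have hA : Real.exp (-x) / (1 - x) ≤ Real.exp (x ^ 2) := by
    rw [div_le_iff₀ hpos]
    have e : Real.exp (x ^ 2) = Real.exp (-x) * Real.exp (x + x ^ 2) := by
      rw [← Real.exp_add]
      congr 1
      ring
    rw [e]
    nlinarith [mul_le_mul_of_nonneg_left key (Real.exp_pos (-x)).le]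
  have hB : c / (1 - x) ≤ 2 * c := by
    rw [div_le_iff₀ hpos]
    nlinarith
  rw [Real.exp_add]
  exact mul_le_mul hA (Real.exp_le_exp.mpr hB) (Real.exp_pos _).le (Real.exp_pos _).le
end

section
/- Let v > 0, let m₁, m₂ ∈ ℝ, set ζ = m₁² + m₂², and let λ ∈ ℝ with |λ| < 1/(4v). Then, with γ_{m,v} denoting the Gaussian probability measure on ℝ with mean m and variance v, ∫ exp( λ·( x² + y² − (ζ + 2v) ) ) d(γ_{m₁,v} × γ_{m₂,v})(x, y) ≤ exp( (4v² + 4vζ)·λ² ). -/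
open MeasureTheory ProbabilityTheory

lemma aux_integral (v : NNReal) (hv : 0 < v) (m l s : ℝ) (hs : s = 1 - 2 * l * v) (hs0 : 0 < s) :
    ∫ x, Real.exp (l * x ^ 2) ∂(gaussianReal m v) = (√s)⁻¹ * Real.exp (l * m ^ 2 / s) := by
  have hv' : (0 : ℝ) < v := hv
  rw [integral_gaussianReal_eq_integral_smul hv.ne']
  have hw : v / s.toNNReal ≠ 0 := (div_pos hv (Real.toNNReal_pos.mpr hs0)).ne'
  have key : ∀ x, gaussianPDFReal m v x • Real.exp (l * x ^ 2) =
      ((√s)⁻¹ * Real.exp (l * m ^ 2 / s)) * gaussianPDFReal (m / s) (v / s.toNNReal) x := by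
    intro x
    have hc : ((v / s.toNNReal : NNReal) : ℝ) = v / s := by
      rw [NNReal.coe_div, Real.coe_toNNReal _ hs0.le]
    simp only [gaussianPDFReal, hc, smul_eq_mul]
    have h1 : √(2 * Real.pi * (v / s)) = √(2 * Real.pi * v) / √s := by
      rw [← mul_div_assoc, Real.sqrt_div (by positivity)]
    have h2 : -(x - m) ^ 2 / (2 * v) + l * x ^ 2 =
        l * m ^ 2 / s + -(x - m / s) ^ 2 / (2 * (v / s)) := by
      have : s ≠ 0 := hs0.ne'
      field_simp
      rw [hs]
      ring
    have h3 : √s ≠ 0 := (Real.sqrt_pos.mpr hs0).ne'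
    rw [h1, mul_assoc, ← Real.exp_add, h2, Real.exp_add]
    field_simp
  simp_rw [key]
  rw [integral_const_mul, integral_gaussianPDFReal_eq_one _ hw, mul_one]

lemma aux_exp (u : ℝ) (h1 : -(1 / 2) < u) (h2 : u < 1 / 2) :
    (1 - u)⁻¹ * Real.exp (-u) ≤ Real.exp (u ^ 2) := by
  have hp : 0 < 1 - u := by linarith
  have hk : 1 ≤ (1 - u) * Real.exp (u + u ^ 2) := by
    rcases le_or_gt 0 u with h | h
    · have hq := Real.quadratic_le_exp_of_nonneg (x := u + u ^ 2) (by positivity)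
      have := mul_le_mul_of_nonneg_left hq hp.le
      refine le_trans ?_ this
      have h4 : 2 * u ≤ (1 - u) * (1 + u) ^ 2 := by
        nlinarith [mul_nonneg h (sub_nonneg.2 h2.le), mul_nonneg (mul_nonneg h h) (sub_nonneg.2 h2.le)]
      nlinarith [mul_le_mul_of_nonneg_left h4 (sq_nonneg u)]
    · have hq := Real.add_one_le_exp (u + u ^ 2)
      have := mul_le_mul_of_nonneg_left hq hp.le
      refine le_trans ?_ this
      nlinarith [mul_nonneg (neg_nonneg.2 h.le) (sq_nonneg u)]
  rw [inv_mul_le_iff₀ hp, Real.exp_neg, inv_le_iff_one_le_mul₀ (Real.exp_pos _)]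
  rw [Real.exp_add] at hk
  linarith

/-- Sub-exponential moment generating function bound of Lemma 1: for independent
`X₁ ∼ N(m₁, v)`, `X₂ ∼ N(m₂, v)` with `ζ = m₁² + m₂²`, the centered MGF of
`X₁² + X₂²` (mean `ζ + 2v`) satisfies
`E[exp(λ(X₁² + X₂² − (ζ + 2v)))] ≤ exp((4v² + 4vζ)λ²)` for `|λ| < 1/(4v)`. -/
theorem noncentral_chisq_two_subexponential (v : NNReal) (hv : 0 < v) (m₁ m₂ : ℝ)
    (ζ : ℝ) (hζ : ζ = m₁ ^ 2 + m₂ ^ 2)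
    (l : ℝ) (hl : |l| < 1 / (4 * (v : ℝ))) :
    ∫ p : ℝ × ℝ, Real.exp (l * (p.1 ^ 2 + p.2 ^ 2 - (ζ + 2 * (v : ℝ))))
        ∂((gaussianReal m₁ v).prod (gaussianReal m₂ v))
      ≤ Real.exp ((4 * (v : ℝ) ^ 2 + 4 * (v : ℝ) * ζ) * l ^ 2) := by
  have hv' : (0 : ℝ) < v := hv
  have hlv : |l| * (4 * v) < 1 := by rwa [lt_div_iff₀ (by positivity)] at hl
  have ha := mul_le_mul_of_nonneg_right (le_abs_self l) hv'.le
  have hb := mul_le_mul_of_nonneg_right (neg_abs_le l) hv'.le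
  obtain ⟨s, hs⟩ : ∃ s, s = 1 - 2 * l * (v : ℝ) := ⟨_, rfl⟩
  have hs2 : 1 / 2 < s := by rw [hs]; linarith
  have hs0 : 0 < s := by linarith
  have e : ∀ p : ℝ × ℝ, Real.exp (l * (p.1 ^ 2 + p.2 ^ 2 - (ζ + 2 * (v : ℝ)))) =
      Real.exp (-(l * (ζ + 2 * v))) * (Real.exp (l * p.1 ^ 2) * Real.exp (l * p.2 ^ 2)) := by
    intro p
    rw [← Real.exp_add, ← Real.exp_add]
    ring_nf
  simp_rw [e]
  rw [integral_const_mul, integral_prod_mul (fun x : ℝ => Real.exp (l * x ^ 2))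
    (fun x : ℝ => Real.exp (l * x ^ 2)), aux_integral v hv m₁ l s hs hs0,
    aux_integral v hv m₂ l s hs hs0]
  have hz : 0 ≤ ζ := by rw [hζ]; positivity
  have hu := aux_exp (2 * l * v) (by linarith) (by linarith)
  rw [← hs] at hu
  have hss : (√s)⁻¹ * (√s)⁻¹ = s⁻¹ := by rw [← mul_inv, Real.mul_self_sqrt hs0.le]
  have hE : l * m₁ ^ 2 / s + l * m₂ ^ 2 / s + -(l * (ζ + 2 * v)) =
      -(2 * l * v) + 2 * l ^ 2 * v * ζ / s := by
    rw [hζ]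
    field_simp
    rw [hs]
    ring
  have h5 : 2 * l ^ 2 * v * ζ / s ≤ 4 * v * ζ * l ^ 2 := by
    rw [div_le_iff₀ hs0]
    have : 0 ≤ l ^ 2 * v * ζ := by positivity
    nlinarith
  calc _ = ((√s)⁻¹ * (√s)⁻¹) * Real.exp (l * m₁ ^ 2 / s + l * m₂ ^ 2 / s + -(l * (ζ + 2 * v))) := by
        rw [Real.exp_add, Real.exp_add]; ring
    _ = (s⁻¹ * Real.exp (-(2 * l * v))) * Real.exp (2 * l ^ 2 * v * ζ / s) := by
        rw [hss, hE, Real.exp_add]; ring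
    _ ≤ Real.exp ((2 * l * v) ^ 2) * Real.exp (4 * v * ζ * l ^ 2) := by gcongr
    _ = _ := by rw [← Real.exp_add]; ring_nf
end

section
/- Let (Ω, μ) be a probability space, let F, V : Ω → ℝ be measurable with V(ω) ≥ 0 for all ω, and let f ∈ ℝ, ν ≥ 0, β > 0, B ≥ 1, C ≥ 1 be reals and N ≥ 2 an integer. Assume: (i) μ{ ω : F(ω) − f ≥ √(4Bν²β/N) } ≤ exp(−β); (ii) μ{ ω : f − F(ω) ≥ √(4Bν²β/N) } ≤ exp(−β); and (iii) μ{ ω : ν > V(ω) + √(2Cβ/(N−1)) } ≤ exp(−β). Then μ{ ω : |F(ω) − f| ≥ √(4B·V(ω)²·β/N) + 2√(2BC)·β/(N−1) } ≤ 3·exp(−β). -/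
open MeasureTheory

/-- Lemma 2 of the paper (abstract form): combining the two one-sided boosted
concentration bounds with the Maurer–Pontil empirical-standard-deviation bound
yields the data-driven confidence interval with failure probability `3·exp(−β)`. -/
theorem empirical_variance_confidence {Ω : Type*} [MeasurableSpace Ω]
    (μ : Measure Ω) [IsProbabilityMeasure μ]
    (F V : Ω → ℝ) (hF : Measurable F) (hV : Measurable V) (hVnonneg : ∀ ω, 0 ≤ V ω)
    (f ν β B C : ℝ) (hν : 0 ≤ ν) (hβ : 0 < β) (hB : 1 ≤ B) (hC : 1 ≤ C)
    (N : ℕ) (hN : 2 ≤ N)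
    (h1 : μ {ω | F ω - f ≥ Real.sqrt (4 * B * ν ^ 2 * β / N)}
      ≤ ENNReal.ofReal (Real.exp (-β)))
    (h2 : μ {ω | f - F ω ≥ Real.sqrt (4 * B * ν ^ 2 * β / N)}
      ≤ ENNReal.ofReal (Real.exp (-β)))
    (h3 : μ {ω | ν > V ω + Real.sqrt (2 * C * β / ((N : ℝ) - 1))}
      ≤ ENNReal.ofReal (Real.exp (-β))) :
    μ {ω | |F ω - f| ≥ Real.sqrt (4 * B * V ω ^ 2 * β / N)
        + 2 * Real.sqrt (2 * B * C) * β / ((N : ℝ) - 1)}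
      ≤ ENNReal.ofReal (3 * Real.exp (-β)) := by
  have hN1 : (0 : ℝ) < (N : ℝ) - 1 := by
    have : (2 : ℝ) ≤ N := by exact_mod_cast hN
    linarith
  have hN0 : (0 : ℝ) < N := by linarith
  have hB0 : 0 < B := by linarith
  have hC0 : 0 < C := by linarith
  have hsq : ∀ x : ℝ, 0 ≤ x →
      Real.sqrt (4 * B * x ^ 2 * β / N) = Real.sqrt (4 * B * β / N) * x := by
    intro x hx
    rw [show 4 * B * x ^ 2 * β / N = (4 * B * β / N) * x ^ 2 by ring,
      Real.sqrt_mul (by positivity), Real.sqrt_sq hx]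
  have hprod : Real.sqrt (4 * B * β / N) * Real.sqrt (2 * C * β / ((N : ℝ) - 1))
      ≤ 2 * Real.sqrt (2 * B * C) * β / ((N : ℝ) - 1) := by
    rw [← Real.sqrt_mul (by positivity)]
    apply Real.sqrt_le_iff.mpr
    refine ⟨by positivity, ?_⟩
    have e : (2 * Real.sqrt (2 * B * C) * β / ((N : ℝ) - 1)) ^ 2
        = (4 * B * β / ((N : ℝ) - 1)) * (2 * C * β / ((N : ℝ) - 1)) := by
      rw [div_pow, mul_pow, mul_pow, Real.sq_sqrt (by positivity)]
      field_simp
      norm_num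
    rw [e]
    have hle : 4 * B * β / (N : ℝ) ≤ 4 * B * β / ((N : ℝ) - 1) :=
      div_le_div_of_nonneg_left (by positivity) hN1 (by linarith)
    exact mul_le_mul_of_nonneg_right hle (by positivity)
  have hsub : {ω | |F ω - f| ≥ Real.sqrt (4 * B * V ω ^ 2 * β / N)
        + 2 * Real.sqrt (2 * B * C) * β / ((N : ℝ) - 1)} ⊆
      ({ω | F ω - f ≥ Real.sqrt (4 * B * ν ^ 2 * β / N)} ∪
        {ω | f - F ω ≥ Real.sqrt (4 * B * ν ^ 2 * β / N)}) ∪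
        {ω | ν > V ω + Real.sqrt (2 * C * β / ((N : ℝ) - 1))} := by
    intro ω hω
    simp only [Set.mem_union, Set.mem_ofPred_eq, ge_iff_le, gt_iff_lt] at hω ⊢
    by_cases h : V ω + Real.sqrt (2 * C * β / ((N : ℝ) - 1)) < ν
    · exact Or.inr h
    · left
      have h' := mul_le_mul_of_nonneg_left (not_lt.mp h) (Real.sqrt_nonneg (4 * B * β / N))
      rw [hsq _ (hVnonneg ω)] at hω
      rw [hsq _ hν]
      have h4 : Real.sqrt (4 * B * β / N) * ν ≤ |F ω - f| := by linarith
      rcases le_abs.mp h4 with h5 | h5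
      · exact Or.inl h5
      · right; linarith
  have hexp := (Real.exp_pos (-β)).le
  calc _ ≤ _ := measure_mono hsub
    _ ≤ _ := (measure_union_le _ _).trans (add_le_add (measure_union_le _ _) le_rfl)
    _ ≤ _ := add_le_add (add_le_add h1 h2) h3
    _ = _ := by
      rw [← ENNReal.ofReal_add hexp hexp, ← ENNReal.ofReal_add (by positivity) hexp]
      congr 1
      ring
end

section
/- Let ι be a finite type with at least two elements, and let f̂, D : ι → ℝ with D(j) ≥ 0 for all j. Define U(j) = f̂(j) + D(j), L(j) = f̂(j) − D(j), and G(j) = (max over k ≠ j of U(k)) − L(j). Let γ ∈ ι satisfy G(γ) ≤ G(j) for all j ∈ ι, and let u ∈ ι satisfy u ≠ γ and U(j) ≤ U(u) for all j ≠ γ. Then: (a) if D(u) ≥ D(γ) then L(u) ≤ L(γ); and (b) if D(γ) ≥ D(u) then U(u) ≤ U(γ). -/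
open Finset

/-- For a nontrivial finite index type, the finset of indices different from `j`
is nonempty. -/
theorem erase_univ_nonempty {ι : Type*} [Fintype ι] [DecidableEq ι] [Nontrivial ι]
    (j : ι) : (Finset.univ.erase j).Nonempty := by
  obtain ⟨k, hk⟩ := exists_ne j
  exact ⟨k, Finset.mem_erase.mpr ⟨hk, Finset.mem_univ k⟩⟩

/-- Implication part of Lemma 3 of the paper (one fixed level of SSE):
with `U`, `L` the upper/lower confidence bounds, `G` the gaps, `γ` the arm
minimizing the gap and `u` the best-of-worst arm, the sampled arm's selection
is consistent with the confidence-bound ordering. -/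
theorem sse_sampling_choices {ι : Type*} [Fintype ι] [DecidableEq ι] [Nontrivial ι]
    (fhat D : ι → ℝ) (hD : ∀ j, 0 ≤ D j)
    (U L G : ι → ℝ)
    (hU : ∀ j, U j = fhat j + D j)
    (hL : ∀ j, L j = fhat j - D j)
    (hG : ∀ j, G j = (Finset.univ.erase j).sup' (erase_univ_nonempty j) U - L j)
    (γ : ι) (hγ : ∀ j, G γ ≤ G j)
    (u : ι) (huγ : u ≠ γ) (hu : ∀ j, j ≠ γ → U j ≤ U u) :
    (D γ ≤ D u → L u ≤ L γ) ∧ (D u ≤ D γ → U u ≤ U γ) := by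
  have h1 : U u ≤ (Finset.univ.erase γ).sup' (erase_univ_nonempty γ) U :=
    Finset.le_sup' U (Finset.mem_erase.mpr ⟨huγ, Finset.mem_univ u⟩)
  have key : U γ ≤ U u → L u ≤ L γ := by
    intro h
    have h2 : (Finset.univ.erase u).sup' (erase_univ_nonempty u) U ≤ U u := by
      apply Finset.sup'_le
      intro j _
      by_cases hj : j = γ
      · rw [hj]; exact h
      · exact hu j hj
    have h3 := hγ u
    rw [hG, hG] at h3
    linarith
  have a1 := hU u
  have a2 := hU γ
  have a3 := hL u
  have a4 := hL γ
  constructor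
  · intro h
    by_contra hc
    push Not at hc
    have := key (by linarith)
    linarith
  · intro h
    by_contra hc
    push Not at hc
    have := key (by linarith)
    linarith
end

section
/- Let ι be a finite type with at least two elements, and let f̂, D : ι → ℝ with D(j) ≥ 0 for all j. Define U(j) = f̂(j) + D(j), L(j) = f̂(j) − D(j), and G(j) = (max over k ≠ j of U(k)) − L(j). Let γ ∈ ι satisfy G(γ) ≤ G(j) for all j ∈ ι, and let u ∈ ι satisfy u ≠ γ and U(j) ≤ U(u) for all j ≠ γ. Then G(γ) ≤ 2·max(D(u), D(γ)). -/
open Finset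

/-- Gap bound (eq. (31)) of Lemma 3 of the paper (one fixed level of SSE):
the minimal gap is at most twice the confidence radius of the sampled arm,
i.e. twice the larger of the confidence radii of `u` and `γ`. -/
theorem sse_gap_bound {ι : Type*} [Fintype ι] [DecidableEq ι] [Nontrivial ι]
    (fhat D : ι → ℝ) (hD : ∀ j, 0 ≤ D j)
    (U L G : ι → ℝ)
    (hU : ∀ j, U j = fhat j + D j)
    (hL : ∀ j, L j = fhat j - D j)
    (hG : ∀ j, G j = (Finset.univ.erase j).sup' (erase_univ_nonempty j) U - L j)
    (γ : ι) (hγ : ∀ j, G γ ≤ G j)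
    (u : ι) (huγ : u ≠ γ) (hu : ∀ j, j ≠ γ → U j ≤ U u) :
    G γ ≤ 2 * max (D u) (D γ) := by
  have h1 : G γ ≤ U u - L γ := by
    rw [hG γ]
    have : (Finset.univ.erase γ).sup' (erase_univ_nonempty γ) U ≤ U u :=
      Finset.sup'_le _ _ fun k hk => hu k (Finset.mem_erase.mp hk).1
    linarith
  have h2 : G u ≤ max (U γ) (U u) - L u := by
    rw [hG u]
    have : (Finset.univ.erase u).sup' (erase_univ_nonempty u) U ≤ max (U γ) (U u) := by
      refine Finset.sup'_le _ _ fun k _ => ?_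
      by_cases hk : k = γ
      · rw [hk]; exact le_max_left _ _
      · exact (hu k hk).trans (le_max_right _ _)
    linarith
  have h3 := hγ u
  have h4 := le_max_left (D u) (D γ)
  have h5 := le_max_right (D u) (D γ)
  have e1 := hU u
  have e2 := hU γ
  have e3 := hL u
  have e4 := hL γ
  rcases le_total (fhat u) (fhat γ) with h | h
  · linarith
  · rcases max_choice (U γ) (U u) with hm | hm <;> rw [hm] at h2 <;> linarith
end

section
/- Let ι be a finite type with at least two elements, and let f, f̂, D : ι → ℝ with D(j) ≥ 0 for all j. Define U(j) = f̂(j) + D(j), L(j) = f̂(j) − D(j), and G(j) = (max over k ≠ j of U(k)) − L(j). Let i* ∈ ι satisfy f(j) < f(i*) for all j ≠ i*, and define Δ(j) = f(i*) − f(j) for j ≠ i* and Δ(i*) = f(i*) − (max over j ≠ i* of f(j)). Let γ ∈ ι satisfy G(γ) ≤ G(j) for all j ∈ ι, and let u ∈ ι satisfy u ≠ γ and U(j) ≤ U(u) for all j ≠ γ. Assume the confidence event holds: |f̂(j) − f(j)| < D(j) for all j ∈ ι. If i ∈ {u, γ} is such that either (i = u and D(γ) ≤ D(u)) or (i = γ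 and D(u) ≤ D(γ)), then G(γ) ≤ min(0, 2·D(i) − Δ(i)) + 2·D(i). -/
open Finset

/-- Lemma 4 of the paper (one fixed level of SSE): on the confidence event, the
minimal gap `G γ` is bounded by `min(0, 2 D i − Δ i) + 2 D i` where `i` is the
sampled arm (the one among `{u, γ}` with the larger confidence radius). -/
theorem sse_gap_suboptimality_bound {ι : Type*} [Fintype ι] [DecidableEq ι] [Nontrivial ι]
    (f fhat D : ι → ℝ) (hD : ∀ j, 0 ≤ D j)
    (U L G : ι → ℝ)
    (hU : ∀ j, U j = fhat j + D j)
    (hL : ∀ j, L j = fhat j - D j)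
    (hG : ∀ j, G j = (Finset.univ.erase j).sup' (erase_univ_nonempty j) U - L j)
    (istar : ι) (histar : ∀ j, j ≠ istar → f j < f istar)
    (Δ : ι → ℝ)
    (hΔ : ∀ j, j ≠ istar → Δ j = f istar - f j)
    (hΔstar : Δ istar = f istar -
      (Finset.univ.erase istar).sup' (erase_univ_nonempty istar) f)
    (γ : ι) (hγ : ∀ j, G γ ≤ G j)
    (u : ι) (huγ : u ≠ γ) (hu : ∀ j, j ≠ γ → U j ≤ U u)
    (hconf : ∀ j, |fhat j - f j| < D j)
    (i : ι) (hi : (i = u ∧ D γ ≤ D u) ∨ (i = γ ∧ D u ≤ D γ)) :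
    G γ ≤ min 0 (2 * D i - Δ i) + 2 * D i := by
  have hc : ∀ j, fhat j - D j < f j ∧ f j < fhat j + D j := fun j => by
    have := abs_lt.mp (hconf j)
    constructor <;> linarith [this.1, this.2]
  have hGγ : G γ = U u - L γ := by
    rw [hG γ]
    congr 1
    apply le_antisymm
    · exact Finset.sup'_le _ _ fun k hk => hu k (Finset.ne_of_mem_erase hk)
    · exact Finset.le_sup' U (Finset.mem_erase.mpr ⟨huγ, Finset.mem_univ u⟩)
  have hGu : G u ≤ max (U γ) (U u) - L u := by
    rw [hG u]
    refine sub_le_sub_right (Finset.sup'_le _ _ fun k _ => ?_) _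
    by_cases hk : k = γ
    · subst hk; exact le_max_left _ _
    · exact (hu k hk).trans (le_max_right _ _)
  have hstar : ∀ j, j ≠ istar → Δ istar ≤ f istar - f j := fun j hj => by
    rw [hΔstar]
    exact sub_le_sub_left
      (Finset.le_sup' f (Finset.mem_erase.mpr ⟨hj, Finset.mem_univ j⟩)) _
  have hmin := hγ u
  have cu := hc u
  have cγ := hc γ
  have cs := hc istar
  have e1 := hU u
  have e2 := hU γ
  have e3 := hL u
  have e4 := hL γ
  have h1 : G γ ≤ 2 * D i := by
    rcases max_cases (U γ) (U u) with ⟨h, _⟩ | ⟨h, _⟩ <;> rw [h] at hGu <;>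
      rcases hi with ⟨rfl, hd⟩ | ⟨rfl, hd⟩ <;> linarith
  have h2 : G γ ≤ 2 * D i - Δ i + 2 * D i := by
    have hs : γ ≠ istar → f istar ≤ U u := fun h => by
      have := hu istar h.symm
      have := hU istar
      linarith
    rcases hi with ⟨rfl, hd⟩ | ⟨rfl, hd⟩
    · by_cases his : i = istar
      · subst his
        have := hstar γ huγ.symm
        linarith
      · have := hΔ i his
        by_cases hg : γ = istar
        · subst hg; linarith
        · have := hs hg
          linarith
    · by_cases his : i = istar
      · subst his
        have := hstar u huγ
        linarith
      · have := hΔ i his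
        have := hs his
        linarith
  rcases min_cases 0 (2 * D i - Δ i) with ⟨h, _⟩ | ⟨h, _⟩ <;> rw [h] <;> linarith
end
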